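/- For all real numbers α > 0 and β > 0 and every natural number n, the integral over γ ∈ (0,∞) of the product of the Poisson probability mass at n with rate γ and the gamma density with shape α and inverse scale β equals the closed-form evidence: ∫₀^∞ (γ^n e^{−γ}/n!) · (β^α/Γ(α)) γ^{α−1} e^{−βγ} dγ = Γ(α+n) β^α / (n! · Γ(α) · (β+1)^{α+n}). -/

import Mathlib

/-- The gamma probability density function with shape `a > 0` and inverse scale `b > 0`. -/
noncomputable def gammaPdf (a b γ : ℝ) : ℝ :=
  b ^ a / Real.Gamma a * γ ^ (a - 1) * Real.exp (-b * γ)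

/-- The Poisson probability mass function with rate `γ` evaluated at `n`. -/
noncomputable def poissonPmf (n : ℕ) (γ : ℝ) : ℝ :=
  γ ^ n * Real.exp (-γ) / (n.factorial : ℝ)

/-- The product of the Poisson mass and the gamma density is a constant multiple of the
unnormalized gamma density with shape `a + n` and inverse scale `b + 1`. -/
theorem poissonPmf_mul_gammaPdf (a b : ℝ) (n : ℕ) {γ : ℝ} (hγ : 0 < γ) :
    poissonPmf n γ * gammaPdf a b γ =
      b ^ a / ((n.factorial : ℝ) * Real.Gamma a) *
        (γ ^ (a + n - 1) * Real.exp (-((b + 1) * γ))) := by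
  have hpow : γ ^ (a + n - 1) = γ ^ n * γ ^ (a - 1) := by
    rw [← Real.rpow_natCast, ← Real.rpow_add hγ]
    ring_nf
  have hexp : Real.exp (-((b + 1) * γ)) = Real.exp (-γ) * Real.exp (-b * γ) := by
    rw [← Real.exp_add]
    ring_nf
  rw [poissonPmf, gammaPdf, hpow, hexp]
  ring

/-- Gamma–Poisson marginal evidence: integrating the Poisson mass at `n` against the
gamma density with shape `α` and inverse scale `β` gives the negative-binomial evidence. -/
theorem gamma_poisson_evidence (α β : ℝ) (hα : 0 < α) (hβ : 0 < β) (n : ℕ) :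
    ∫ γ in Set.Ioi (0 : ℝ), poissonPmf n γ * gammaPdf α β γ =
      Real.Gamma (α + n) * β ^ α /
        ((n.factorial : ℝ) * Real.Gamma α * (β + 1) ^ (α + (n : ℝ))) := by
  have hb : 0 < β + 1 := by positivity
  have ha : 0 < α + n := by positivity
  rw [MeasureTheory.setIntegral_congr_fun measurableSet_Ioi
      fun γ hγ => poissonPmf_mul_gammaPdf α β n hγ,
    MeasureTheory.integral_const_mul, Real.integral_rpow_mul_exp_neg_mul_Ioi ha hb,
    one_div, Real.inv_rpow hb.le]
  ring
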